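/- Let H be a subgroup of a countably infinite discrete group G, (X,H,α) a topological dynamical system, and (X_H^G, G, α^{H\G}) the co-induced system. Then h*_{top}(X_H^G, G) ≥ h*_{top}(X, H). -/

import Mathlib

open Filter Topology Set
open scoped ENNReal Classical

section EntropyDefs

variable {G X : Type*}

/-- `𝒰` is an open cover of `X`. -/
def IsOpenCover [TopologicalSpace X] (𝒰 : Set (Set X)) : Prop :=
  (∀ U ∈ 𝒰, IsOpen U) ∧ ⋃₀ 𝒰 = Set.univ

/-- `N(𝒰)`: the minimal cardinality of a finite subcover of `𝒰`
(junk value `0` if no finite subcover exists). -/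
noncomputable def coverN (𝒰 : Set (Set X)) : ℕ :=
  sInf {n : ℕ | ∃ F : Finset (Set X), ↑F ⊆ 𝒰 ∧ F.card = n ∧ ⋃₀ (F : Set (Set X)) = Set.univ}

/-- The join `⋁_{i=1}^n α_{g_i⁻¹}(𝒰)` of the covers `α_{g_i⁻¹}(𝒰) = (α g_i)⁻¹'(𝒰)`. -/
def joinPull (α : G → X → X) (𝒰 : Set (Set X)) {n : ℕ} (g : Fin n → G) : Set (Set X) :=
  {V | ∃ U : Fin n → Set X, (∀ i, U i ∈ 𝒰) ∧ V = ⋂ i, α (g i) ⁻¹' U i}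

/-- Topological sequence entropy of the cover `𝒰` along the sequence `𝔰`:
`h_top^𝔰(𝒰,G) = limsup_n (1/n) log N(⋁_{i=1}^n α_{𝔰(i)⁻¹}(𝒰))`, valued in `[0,∞]`. -/
noncomputable def seqEntCover (α : G → X → X) (𝔰 : ℕ → G) (𝒰 : Set (Set X)) : ℝ≥0∞ :=
  Filter.atTop.limsup fun n : ℕ =>
    ENNReal.ofReal (Real.log (coverN (joinPull α 𝒰 fun i : Fin n => 𝔰 i)) / n)

/-- Topological sequence entropy of the action along `𝔰`: supremum over all open covers. -/
noncomputable def seqEnt [TopologicalSpace X] (α : G → X → X) (𝔰 : ℕ → G) : ℝ≥0∞ :=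
  ⨆ 𝒰 ∈ {𝒰 : Set (Set X) | IsOpenCover 𝒰}, seqEntCover α 𝔰 𝒰

/-- `p*_{X,G,𝒰}(n) = max_{(g_1,…,g_n) ∈ Gⁿ} N(⋁_{i=1}^n α_{g_i⁻¹}(𝒰))`. -/
noncomputable def patN (α : G → X → X) (𝒰 : Set (Set X)) (n : ℕ) : ℕ :=
  sSup {m : ℕ | ∃ g : Fin n → G, m = coverN (joinPull α 𝒰 g)}

/-- Maximal pattern entropy of the cover `𝒰`: `lim_n (1/n) log p*_{X,G,𝒰}(n)`
(the limit exists by subadditivity and coincides with the limsup used here). -/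
noncomputable def patEntCover (α : G → X → X) (𝒰 : Set (Set X)) : ℝ≥0∞ :=
  Filter.atTop.limsup fun n : ℕ => ENNReal.ofReal (Real.log (patN α 𝒰 n) / n)

/-- Maximal pattern entropy `h*_top(X,G)`: supremum over all open covers. -/
noncomputable def patEnt [TopologicalSpace X] (α : G → X → X) : ℝ≥0∞ :=
  ⨆ 𝒰 ∈ {𝒰 : Set (Set X) | IsOpenCover 𝒰}, patEntCover α 𝒰

/-- `α` is an action of `G` on `X` by homeomorphisms. -/
def IsActionBy [Group G] [TopologicalSpace X] (α : G → X → X) : Prop :=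
  (∀ x, α 1 x = x) ∧ (∀ g h x, α (g * h) x = α g (α h x)) ∧ ∀ g, Continuous (α g)

/-- `I ⊆ G` is an independence set for the tuple `(A 1, …, A k)`:
for every nonempty finite `F ⊆ I` and every `ω : F → {1,…,k}` we have
`⋂_{g ∈ F} α_{g⁻¹}(A (ω g)) ≠ ∅`. -/
def IsIndepSet (α : G → X → X) {k : ℕ} (A : Fin k → Set X) (I : Set G) : Prop :=
  ∀ F : Finset G, ↑F ⊆ I → F.Nonempty → ∀ ω : G → Fin k,
    (⋂ g ∈ F, α g ⁻¹' A (ω g)).Nonempty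

/-- The tuple `(A 1, …, A k)` has arbitrarily large finite independence sets. -/
def HasArbLargeIndep (α : G → X → X) {k : ℕ} (A : Fin k → Set X) : Prop :=
  ∀ n : ℕ, ∃ F : Finset G, n ≤ F.card ∧ IsIndepSet α A ↑F

/-- `(x 1, …, x k)` is an IN-tuple: every product neighbourhood has arbitrarily large
finite independence sets. -/
def IsINTuple [TopologicalSpace X] (α : G → X → X) {k : ℕ} (x : Fin k → X) : Prop :=
  ∀ U : Fin k → Set X, (∀ i, IsOpen (U i)) → (∀ i, x i ∈ U i) → HasArbLargeIndep α U

/-- The action `α` of `G` on `X` is (topologically) weak-mixing. -/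
def IsWeakMixing [TopologicalSpace X] (α : G → X → X) : Prop :=
  ∀ U₁ U₂ V₁ V₂ : Set X, IsOpen U₁ → IsOpen U₂ → IsOpen V₁ → IsOpen V₂ →
    U₁.Nonempty → U₂.Nonempty → V₁.Nonempty → V₂.Nonempty →
    ∃ g : G, (U₁ ∩ α g '' V₁).Nonempty ∧ (U₂ ∩ α g '' V₂).Nonempty

/-- `(x₁,x₂)` is a sequence entropy pair. -/
def IsSeqEntropyPair [TopologicalSpace X] (α : G → X → X) (x₁ x₂ : X) : Prop :=
  x₁ ≠ x₂ ∧ ∀ A₁ A₂ : Set X, IsClosed A₁ → IsClosed A₂ →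
    A₁ ∈ nhds x₁ → A₂ ∈ nhds x₂ → Disjoint A₁ A₂ →
    ∃ 𝔰 : ℕ → G, 0 < seqEntCover α 𝔰 {A₁ᶜ, A₂ᶜ}

/-- `(x 1, …, x k)` is a sequence entropy tuple: it is not diagonal, and whenever
`U i` are closed neighbourhoods of the `x i` which coincide on equal coordinates and are
pairwise disjoint on distinct coordinates (i.e. pairwise disjoint closed neighbourhoods of
the distinct points of the tuple), some sequence gives positive sequence entropy for the
cover by their complements. -/
def IsSeqEntropyTuple [TopologicalSpace X] (α : G → X → X) {k : ℕ} (x : Fin k → X) : Prop :=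
  (∃ i j, x i ≠ x j) ∧ ∀ U : Fin k → Set X,
    (∀ i, IsClosed (U i)) → (∀ i, U i ∈ nhds (x i)) →
    (∀ i j, x i = x j → U i = U j) → (∀ i j, x i ≠ x j → Disjoint (U i) (U j)) →
    ∃ 𝔰 : ℕ → G, 0 < seqEntCover α 𝔰 (Set.range fun i => (U i)ᶜ)

end EntropyDefs

namespace CoInd

variable {G : Type*} [Group G] (H : Subgroup G)

/-- `H\G`, the space of right cosets of `H` in `G`. -/
abbrev RQ := Quotient (QuotientGroup.rightRel H)

/-- Right multiplication `Hg ↦ H(g·g₀)` on the right coset space. -/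
def rmul (g₀ : G) : RQ H → RQ H :=
  Quotient.map' (fun g => g * g₀) (fun a b hab => by
    rw [QuotientGroup.rightRel_apply] at hab ⊢
    have h2 : b * g₀ * (a * g₀)⁻¹ = b * a⁻¹ := by group
    rw [h2]; exact hab)

/-- `s : H\G → G` is a section of the right cosets with `s(H) = e`. -/
def IsSection (s : RQ H → G) : Prop :=
  (∀ θ : RQ H, Quotient.mk'' (s θ) = θ) ∧ s (Quotient.mk'' 1) = 1

variable {X : Type*}

/-- The co-induced action `α^{H\G}` of `G` on `X_H^G = ∏_{θ ∈ H\G} X`, relative to a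
section `s` of the right cosets:
`(α^{H\G}_{g₀} f)(Hg) = α_{s(Hg)·g₀·s(Hg·g₀)⁻¹} (f (Hg·g₀))`.
(When `s` is a genuine section the element `s(Hg)·g₀·s(Hg·g₀)⁻¹` always lies in `H`,
so the `else` branch is never taken.) -/
noncomputable def coindAct (α : ↥H → X → X) (s : RQ H → G) (g₀ : G)
    (f : RQ H → X) : RQ H → X := fun θ =>
  if h : s θ * g₀ * (s (rmul H g₀ θ))⁻¹ ∈ H then
    α ⟨s θ * g₀ * (s (rmul H g₀ θ))⁻¹, h⟩ (f (rmul H g₀ θ))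
  else f (rmul H g₀ θ)

end CoInd

section Covers

variable {K L X Y : Type*}

/-- An open cover of a compact space has a finite subcover. -/
theorem IsOpenCover.exists_finite_subcover [TopologicalSpace X] [CompactSpace X]
    {𝒰 : Set (Set X)} (h𝒰 : IsOpenCover 𝒰) :
    ∃ F : Finset (Set X), ↑F ⊆ 𝒰 ∧ ⋃₀ (F : Set (Set X)) = Set.univ := by
  obtain ⟨T, hT, hfin, hcov⟩ := isCompact_univ.elim_finite_subcover_image (b := 𝒰) (c := id)
    h𝒰.1 (by simpa only [id, ← sUnion_eq_biUnion] using h𝒰.2.ge)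
  refine ⟨hfin.toFinset, by simpa using hT, ?_⟩
  rw [hfin.coe_toFinset, sUnion_eq_biUnion]
  exact univ_subset_iff.1 hcov

/-- A finite subcover of `𝒰` with `k` elements yields a subcover of the `n`-fold join with at most
`k ^ n` elements. -/
theorem exists_finite_subcover_joinPull (α : K → X → X) {𝒰 : Set (Set X)} {F : Finset (Set X)}
    (hF : ↑F ⊆ 𝒰) (hcov : ⋃₀ (F : Set (Set X)) = Set.univ) {n : ℕ} (g : Fin n → K) :
    ∃ E : Finset (Set X), ↑E ⊆ joinPull α 𝒰 g ∧ E.card ≤ F.card ^ n ∧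
      ⋃₀ (E : Set (Set X)) = Set.univ := by
  refine ⟨(Fintype.piFinset fun _ : Fin n => F).image fun U => ⋂ i, α (g i) ⁻¹' U i, ?_, ?_, ?_⟩
  · intro V hV
    obtain ⟨U, hU, rfl⟩ := Finset.mem_image.1 (Finset.mem_coe.1 hV)
    exact ⟨U, fun i => hF (Fintype.mem_piFinset.1 hU i), rfl⟩
  · refine Finset.card_image_le.trans ?_
    simp [Fintype.card_piFinset]
  · refine eq_univ_of_forall fun x => ?_
    have hx : ∀ i, ∃ U ∈ F, α (g i) x ∈ U := fun i => by
      have h : α (g i) x ∈ ⋃₀ (F : Set (Set X)) := hcov ▸ mem_univ _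
      simpa using h
    choose U hUF hU using hx
    exact ⟨⋂ i, α (g i) ⁻¹' U i, Finset.mem_coe.2 (Finset.mem_image.2
      ⟨U, Fintype.mem_piFinset.2 hUF, rfl⟩), mem_iInter.2 hU⟩

theorem coverN_le_card {𝒰 : Set (Set X)} {F : Finset (Set X)} (hF : ↑F ⊆ 𝒰)
    (hcov : ⋃₀ (F : Set (Set X)) = Set.univ) : coverN 𝒰 ≤ F.card :=
  Nat.sInf_le ⟨F, hF, rfl, hcov⟩

/-- The values over which `patN` takes a supremum are bounded if `𝒰` has a finite subcover. -/
theorem bddAbove_coverN_joinPull (α : K → X → X) {𝒰 : Set (Set X)} {F : Finset (Set X)}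
    (hF : ↑F ⊆ 𝒰) (hcov : ⋃₀ (F : Set (Set X)) = Set.univ) (n : ℕ) :
    BddAbove {m : ℕ | ∃ g : Fin n → K, m = coverN (joinPull α 𝒰 g)} := by
  refine ⟨F.card ^ n, ?_⟩
  rintro _ ⟨g, rfl⟩
  obtain ⟨E, hE, hcard, hEcov⟩ := exists_finite_subcover_joinPull α hF hcov g
  exact (coverN_le_card hE hEcov).trans hcard

/-- Pulling a cover back along a surjection does not decrease `coverN`, provided the pulled back
cover has a finite subcover. -/
theorem coverN_le_coverN_image_preimage {p : Y → X} (hp : Function.Surjective p)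
    {𝒰 : Set (Set X)} {F : Finset (Set Y)} (hF : ↑F ⊆ preimage p '' 𝒰)
    (hcov : ⋃₀ (F : Set (Set Y)) = Set.univ) :
    coverN 𝒰 ≤ coverN (preimage p '' 𝒰) := by
  obtain ⟨E, hE, hcard, hEcov⟩ := Nat.sInf_mem
    (s := {n : ℕ | ∃ F : Finset (Set Y), ↑F ⊆ preimage p '' 𝒰 ∧ F.card = n ∧
      ⋃₀ (F : Set (Set Y)) = Set.univ}) ⟨F.card, F, hF, rfl, hcov⟩
  have hE' : ∀ V ∈ E, image p V ∈ 𝒰 := fun V hV => by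
    obtain ⟨U, hU, rfl⟩ := hE hV
    rwa [image_preimage_eq U hp]
  refine le_trans (coverN_le_card (F := E.image (image p)) ?_ ?_)
    (Finset.card_image_le.trans hcard.le)
  · intro W hW
    obtain ⟨V, hV, rfl⟩ := Finset.mem_image.1 (Finset.mem_coe.1 hW)
    exact hE' V hV
  · refine eq_univ_of_forall fun x => ?_
    obtain ⟨y, rfl⟩ := hp x
    obtain ⟨V, hV, hy⟩ : y ∈ ⋃₀ (E : Set (Set Y)) := hEcov ▸ mem_univ y
    exact ⟨p '' V, Finset.mem_coe.2 (Finset.mem_image_of_mem _ hV), mem_image_of_mem p hy⟩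

/-- Joins commute with pulling back along an equivariant map. -/
theorem joinPull_image_preimage {α : K → X → X} {β : L → Y → Y} {ι : K → L} {p : Y → X}
    (hequiv : ∀ k y, p (β (ι k) y) = α k (p y)) (𝒰 : Set (Set X)) {n : ℕ} (g : Fin n → K) :
    joinPull β (preimage p '' 𝒰) (ι ∘ g) = preimage p '' joinPull α 𝒰 g := by
  have key : ∀ U : Fin n → Set X,
      ⋂ i, β ((ι ∘ g) i) ⁻¹' (p ⁻¹' U i) = p ⁻¹' ⋂ i, α (g i) ⁻¹' U i := fun U => by
    ext y
    simp [hequiv]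
  ext V
  constructor
  · rintro ⟨W, hW, rfl⟩
    choose U hU hUW using hW
    obtain rfl : (fun i => p ⁻¹' U i) = W := funext hUW
    exact ⟨_, ⟨U, hU, rfl⟩, (key U).symm⟩
  · rintro ⟨_, ⟨U, hU, rfl⟩, rfl⟩
    exact ⟨fun i => p ⁻¹' U i, fun i => mem_image_of_mem _ (hU i), (key U).symm⟩

theorem IsOpenCover.image_preimage [TopologicalSpace X] [TopologicalSpace Y] {𝒰 : Set (Set X)}
    (h𝒰 : IsOpenCover 𝒰) {p : Y → X} (hp : Continuous p) : IsOpenCover (preimage p '' 𝒰) := by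
  refine ⟨?_, ?_⟩
  · rintro _ ⟨U, hU, rfl⟩
    exact (h𝒰.1 U hU).preimage hp
  · rw [sUnion_image, ← preimage_iUnion₂, ← sUnion_eq_biUnion, h𝒰.2, preimage_univ]

/-- If `(X, K)` is a factor of the compact system `(Y, L)` restricted along `ι : K → L`, then the
maximal pattern entropy of `(X, K)` is at most that of `(Y, L)`. -/
theorem patEnt_le_of_factor [TopologicalSpace X] [TopologicalSpace Y] [CompactSpace Y]
    {α : K → X → X} {β : L → Y → Y} (ι : K → L) {p : Y → X} (hp : Continuous p)
    (hsurj : Function.Surjective p) (hequiv : ∀ k y, p (β (ι k) y) = α k (p y)) :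
    patEnt α ≤ patEnt β := by
  refine iSup₂_le fun 𝒰 h𝒰 => ?_
  have hV : IsOpenCover (preimage p '' 𝒰) := IsOpenCover.image_preimage h𝒰 hp
  refine le_trans ?_ (le_iSup₂ (f := fun 𝒱 (_ : 𝒱 ∈ {𝒱 : Set (Set Y) | IsOpenCover 𝒱}) =>
    patEntCover β 𝒱) (preimage p '' 𝒰) hV)
  obtain ⟨F, hF, hcov⟩ := hV.exists_finite_subcover
  have hpat : ∀ n, patN α 𝒰 n ≤ patN β (preimage p '' 𝒰) n := fun n => by
    refine csSup_le' ?_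
    rintro _ ⟨g, rfl⟩
    obtain ⟨E, hE, -, hEcov⟩ := exists_finite_subcover_joinPull β hF hcov (ι ∘ g)
    rw [joinPull_image_preimage hequiv] at hE
    refine (coverN_le_coverN_image_preimage hsurj hE hEcov).trans ?_
    rw [← joinPull_image_preimage hequiv]
    exact le_csSup (bddAbove_coverN_joinPull β hF hcov n) ⟨ι ∘ g, rfl⟩
  refine limsup_le_limsup (Eventually.of_forall fun n => ENNReal.ofReal_le_ofReal ?_)
  refine div_le_div_of_nonneg_right ?_ n.cast_nonneg
  rcases Nat.eq_zero_or_pos (patN α 𝒰 n) with h | h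
  · rw [h, Nat.cast_zero, Real.log_zero]
    exact Real.log_natCast_nonneg _
  · exact Real.log_le_log (Nat.cast_pos.2 h) (Nat.cast_le.2 (hpat n))

end Covers

namespace CoInd

/-- The evaluation at the trivial coset is `H`-equivariant. -/
theorem coindAct_apply_one {G X : Type*} [Group G] (H : Subgroup G) (α : ↥H → X → X)
    {s : RQ H → G} (hs : IsSection H s) (h : H) (f : RQ H → X) :
    coindAct H α s h f (Quotient.mk'' 1) = α h (f (Quotient.mk'' 1)) := by
  have hr : rmul H h (Quotient.mk'' 1) = Quotient.mk'' 1 := by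
    refine Quotient.sound' (QuotientGroup.rightRel_apply.2 ?_)
    simp
  simp [coindAct, hr, hs.2]

end CoInd

/-- `h*_top(X_H^G, G) ≥ h*_top(X, H)`. -/
theorem coinduced_maximal_pattern_entropy_ge
    {G X : Type*} [Group G] [Countable G] [Infinite G] [MetricSpace X] [CompactSpace X]
    (H : Subgroup G) (α : ↥H → X → X) (hα : IsActionBy α)
    (s : CoInd.RQ H → G) (hs : CoInd.IsSection H s) :
    patEnt α ≤ patEnt (CoInd.coindAct H α s) := by
  exact patEnt_le_of_factor (fun h : H => (h : G)) (p := fun f => f (Quotient.mk'' 1))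
    (continuous_apply _) (fun x => ⟨fun _ => x, rfl⟩)
    fun h f => CoInd.coindAct_apply_one H α hs h f
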